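/- Let A be a formally real integral domain which is an ℝ-algebra. Let I₀, M₀ be ℝ-linearly independent imaginary units and let a, b, J₀, K₀ be as in Notation 5.1. Let f = f₀ + f₁·ι(I₀) with f₀, f₁ ∈ A, f₁ ≠ 0, and let h ∈ Quaternion A be not I₀-sliced. Then h * f * star h is M₀-sliced if and only if there exist ε ∈ {1, −1} and a nonzero I₀-sliced g ∈ Quaternion A such that h = (1 − ((a + ε)/b)·ι(K₀)) * g. (Theorem 5.4, case (i).) -/

import Mathlib

open Quaternion

/-- The componentwise extension `ι : ℍ[ℝ] → ℍ[A]` of `algebraMap ℝ A`. -/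
noncomputable def qmap {A : Type*} [CommRing A] [Algebra ℝ A] (q : Quaternion ℝ) :
    Quaternion A :=
  ⟨algebraMap ℝ A q.re, algebraMap ℝ A q.imI, algebraMap ℝ A q.imJ, algebraMap ℝ A q.imK⟩

/-- An imaginary unit: a real quaternion with zero real part squaring to `-1`. -/
def IsImaginaryUnit (I : Quaternion ℝ) : Prop := I.re = 0 ∧ I ^ 2 = -1

/-- `q` is `I`-sliced if `q = a + b·ι(I)` for some `a, b ∈ A`. -/
noncomputable def IsSliced {A : Type*} [CommRing A] [Algebra ℝ A]
    (I : Quaternion ℝ) (q : Quaternion A) : Prop :=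
  ∃ a b : A, q = (a : Quaternion A) + (b : Quaternion A) * qmap I

/-- `A` is formally real: a sum of four squares vanishes only trivially. -/
def FormallyRealFour (A : Type*) [CommRing A] : Prop :=
  ∀ a b c d : A, a ^ 2 + b ^ 2 + c ^ 2 + d ^ 2 = 0 → a = 0 ∧ b = 0 ∧ c = 0 ∧ d = 0

section

variable {A : Type*} [CommRing A]

/-- The quaternion with the given components. -/
def ofComponents (r x y z : A) : Quaternion A := ⟨r, x, y, z⟩

@[simp] theorem re_ofComponents (r x y z : A) : (ofComponents r x y z).re = r := rfl

@[simp] theorem imI_ofComponents (r x y z : A) : (ofComponents r x y z).imI = x := rfl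

@[simp] theorem imJ_ofComponents (r x y z : A) : (ofComponents r x y z).imJ = y := rfl

@[simp] theorem imK_ofComponents (r x y z : A) : (ofComponents r x y z).imK = z := rfl

variable [Algebra ℝ A]

@[simp] theorem re_qmap (q : Quaternion ℝ) :
    (qmap q : Quaternion A).re = algebraMap ℝ A q.re := rfl

@[simp] theorem imI_qmap (q : Quaternion ℝ) :
    (qmap q : Quaternion A).imI = algebraMap ℝ A q.imI := rfl

@[simp] theorem imJ_qmap (q : Quaternion ℝ) :
    (qmap q : Quaternion A).imJ = algebraMap ℝ A q.imJ := rfl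

@[simp] theorem imK_qmap (q : Quaternion ℝ) :
    (qmap q : Quaternion A).imK = algebraMap ℝ A q.imK := rfl

theorem qmap_smul (r : ℝ) (q : Quaternion ℝ) :
    (qmap (r • q) : Quaternion A) = algebraMap ℝ A r • qmap q := by
  ext <;> simp [Algebra.smul_def]

theorem qmap_add (p q : Quaternion ℝ) :
    (qmap (p + q) : Quaternion A) = qmap p + qmap q := by
  ext <;> simp

theorem qmap_neg (q : Quaternion ℝ) : (qmap (-q) : Quaternion A) = -qmap q := by
  ext <;> simp

theorem qmap_one : (qmap 1 : Quaternion A) = 1 := by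
  ext <;> simp

theorem qmap_mul (p q : Quaternion ℝ) :
    (qmap (p * q) : Quaternion A) = qmap p * qmap q := by
  ext <;> simp

theorem star_qmap_of_re_eq_zero {q : Quaternion ℝ} (hq : q.re = 0) :
    star (qmap q : Quaternion A) = -qmap q := by
  ext <;> simp [hq]

/-- A right-handed orthonormal triple of imaginary units. -/
structure IsQuaternionTriple (I J K : Quaternion ℝ) : Prop where
  re_left : I.re = 0
  re_mid : J.re = 0
  re_right : K.re = 0
  left_mul_left : I * I = -1
  mid_mul_mid : J * J = -1
  right_mul_right : K * K = -1
  left_mul_mid : I * J = K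
  mid_mul_left : J * I = -K
  right_mul_left : K * I = J
  mid_mul_right : J * K = I

/-- The endomorphism of `ℍ[A]` sending the standard units to the given triple. -/
noncomputable def IsQuaternionTriple.hom (A : Type*) [CommRing A] [Algebra ℝ A]
    {I J K : Quaternion ℝ} (T : IsQuaternionTriple I J K) : Quaternion A →ₐ[A] Quaternion A :=
  QuaternionAlgebra.Basis.liftHom
    { i := qmap I
      j := qmap J
      k := qmap K
      i_mul_i := by simp [← qmap_mul, T.left_mul_left, qmap_neg, qmap_one]
      j_mul_j := by simp [← qmap_mul, T.mid_mul_mid, qmap_neg, qmap_one]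
      i_mul_j := by simp [← qmap_mul, T.left_mul_mid]
      j_mul_i := by simp [← qmap_mul, T.mid_mul_left, qmap_neg] }

namespace IsQuaternionTriple

variable {I J K : Quaternion ℝ} (T : IsQuaternionTriple I J K)

theorem hom_apply (q : Quaternion A) :
    T.hom A q = (q.re : Quaternion A) + q.imI • qmap I + q.imJ • qmap J + q.imK • qmap K :=
  rfl

theorem star_hom (q : Quaternion A) : star (T.hom A q) = T.hom A (star q) := by
  simp [hom_apply, star_qmap_of_re_eq_zero, T.re_left, T.re_mid, T.re_right]

theorem transpose_mul_self {I J K : Quaternion ℝ} (T : IsQuaternionTriple I J K) :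
    (!![I.imI, I.imJ, I.imK; J.imI, J.imJ, J.imK; K.imI, K.imJ, K.imK] : Matrix _ _ ℝ).transpose *
      !![I.imI, I.imJ, I.imK; J.imI, J.imJ, J.imK; K.imI, K.imJ, K.imK] = 1 := by
  rw [mul_eq_one_comm]
  have h₁ := congrArg QuaternionAlgebra.re T.left_mul_left
  have h₂ := congrArg QuaternionAlgebra.re T.mid_mul_mid
  have h₃ := congrArg QuaternionAlgebra.re T.right_mul_right
  have h₄ := congrArg QuaternionAlgebra.re T.left_mul_mid
  have h₅ := congrArg QuaternionAlgebra.re T.right_mul_left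
  have h₆ := congrArg QuaternionAlgebra.re T.mid_mul_right
  simp [T.re_left, T.re_mid, T.re_right] at h₁ h₂ h₃ h₄ h₅ h₆
  ext i j
  fin_cases i <;> fin_cases j <;> simp [Matrix.mul_apply, Fin.sum_univ_three] <;> linarith

theorem hom_surjective : Function.Surjective (T.hom A) := by
  intro q
  have key (i j : Fin 3) := congrArg (algebraMap ℝ A) (congrFun₂ T.transpose_mul_self i j)
  have h₀₀ := key 0 0
  have h₀₁ := key 0 1
  have h₀₂ := key 0 2
  have h₁₁ := key 1 1
  have h₁₂ := key 1 2
  have h₂₂ := key 2 2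
  simp [Matrix.mul_apply, Fin.sum_univ_three] at h₀₀ h₀₁ h₀₂ h₁₁ h₁₂ h₂₂
  let φ := algebraMap ℝ A
  refine ⟨ofComponents q.re (q.imI * φ I.imI + q.imJ * φ I.imJ + q.imK * φ I.imK)
    (q.imI * φ J.imI + q.imJ * φ J.imJ + q.imK * φ J.imK)
    (q.imI * φ K.imI + q.imJ * φ K.imJ + q.imK * φ K.imK), ?_⟩
  ext
  · simp [hom_apply, T.re_left, T.re_mid, T.re_right]
  · simp [hom_apply, φ]
    linear_combination q.imI * h₀₀ + q.imJ * h₀₁ + q.imK * h₀₂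
  · simp [hom_apply, φ]
    linear_combination q.imI * h₀₁ + q.imJ * h₁₁ + q.imK * h₁₂
  · simp [hom_apply, φ]
    linear_combination q.imI * h₀₂ + q.imJ * h₁₂ + q.imK * h₂₂

theorem hom_injective : Function.Injective (T.hom A) :=
  OrzechProperty.injective_of_surjective_endomorphism (T.hom A).toLinearMap T.hom_surjective

theorem isSliced_hom_iff (x y : ℝ) (q : Quaternion A) :
    IsSliced (x • I + y • J) (T.hom A q) ↔
      ∃ c : A, q.imI = c * algebraMap ℝ A x ∧ q.imJ = c * algebraMap ℝ A y ∧ q.imK = 0 := by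
  have key (a c : A) : (a : Quaternion A) + (c : Quaternion A) * qmap (x • I + y • J) =
      T.hom A (ofComponents a (c * algebraMap ℝ A x) (c * algebraMap ℝ A y) 0) := by
    simp [hom_apply, qmap_add, qmap_smul, Quaternion.coe_mul_eq_smul, mul_smul, add_assoc]
  simp only [IsSliced, key, T.hom_injective.eq_iff]
  constructor
  · rintro ⟨a, c, rfl⟩
    exact ⟨c, rfl, rfl, rfl⟩
  · rintro ⟨c, h₁, h₂, h₃⟩
    exact ⟨q.re, c, by ext <;> simp [h₁, h₂, h₃]⟩

theorem isSliced_left_hom_iff (q : Quaternion A) :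
    IsSliced I (T.hom A q) ↔ q.imJ = 0 ∧ q.imK = 0 := by
  simpa using T.isSliced_hom_iff 1 0 q

end IsQuaternionTriple

end

theorem IsImaginaryUnit.normSq_im {I : Quaternion ℝ} (h : IsImaginaryUnit I) :
    I.imI ^ 2 + I.imJ ^ 2 + I.imK ^ 2 = 1 := by
  have := congrArg QuaternionAlgebra.re h.2
  simp [pow_two, h.1] at this
  linarith

theorem one_sub_sq_inner_pos {I M : Quaternion ℝ} (hI : IsImaginaryUnit I)
    (hM : IsImaginaryUnit M) (hind : LinearIndependent ℝ ![I, M]) :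
    0 < 1 - (I.imI * M.imI + I.imJ * M.imJ + I.imK * M.imK) ^ 2 := by
  set a := I.imI * M.imI + I.imJ * M.imJ + I.imK * M.imK with ha
  have h₁ : (M.imI - a * I.imI) ^ 2 + (M.imJ - a * I.imJ) ^ 2 + (M.imK - a * I.imK) ^ 2 =
      1 - a ^ 2 := by
    linear_combination hM.normSq_im + a ^ 2 * hI.normSq_im + 2 * a * ha
  by_contra hneg
  have h₂ : M.imI - a * I.imI = 0 := by nlinarith
  have h₃ : M.imJ - a * I.imJ = 0 := by nlinarith
  have h₄ : M.imK - a * I.imK = 0 := by nlinarith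
  have h₅ : a • I + (-1 : ℝ) • M = 0 := by
    ext
    · simp [hI.1, hM.1]
    all_goals simp; linarith
  simpa using (LinearIndependent.pair_iff.mp hind a (-1) h₅).2

theorem isQuaternionTriple_of_inner {I M : Quaternion ℝ} (hI : IsImaginaryUnit I)
    (hM : IsImaginaryUnit M) {a b : ℝ}
    (ha : a = I.imI * M.imI + I.imJ * M.imJ + I.imK * M.imK) (hb : b ≠ 0)
    (hab : a ^ 2 + b ^ 2 = 1) {J K : Quaternion ℝ}
    (hK : K = (2 * b)⁻¹ • (I * M - M * I)) (hJ : J = K * I) :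
    IsQuaternionTriple I J K ∧ M = a • I + b • J := by
  have hII : I * I = -1 := by rw [← pow_two, hI.2]
  have hIK : I * K = -J := by
    rw [hJ, hK, mul_smul_comm, smul_mul_assoc, ← smul_neg]
    congr 1
    simp only [mul_sub, sub_mul, ← mul_assoc, hII]
    simp only [mul_assoc, hII]
    simp [sub_eq_add_neg]
  have hKre : K.re = 0 := by
    simp [hK, hI.1, hM.1]
    right; ring
  have hKK : K * K = -1 := by
    have h₁ : K.imI ^ 2 + K.imJ ^ 2 + K.imK ^ 2 = 1 := by
      simp [hK, hI.1, hM.1]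
      field_simp
      have := hI.normSq_im
      have := hM.normSq_im
      subst ha
      grind
    ext
    · simp [hKre]; linarith
    all_goals simp [hKre]; try ring
  have hJI : J * I = -K := by rw [hJ, mul_assoc, hII]; simp
  have hIJ : I * J = K := by rw [hJ, ← mul_assoc, hIK, neg_mul, hJI, neg_neg]
  have hJK : J * K = I := by
    rw [hJ, mul_assoc, hIK, mul_neg, hJ, ← mul_assoc, hKK]; simp
  have hMJ : M = a • I + b • J := by
    have := hI.normSq_im
    ext <;> simp [hJ, hK, hI.1, hM.1, ha] <;> field_simp <;> grind
  refine ⟨⟨hI.1, ?_, hKre, hII, ?_, hKK, hIJ, hJI, hJ.symm, hJK⟩, hMJ⟩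
  · have := congrArg QuaternionAlgebra.re hMJ
    simpa [hI.1, hM.1, hb] using this
  · nth_rw 2 [hJ]
    rw [← mul_assoc, hJK, hII]

theorem FormallyRealFour.sq_add_sq_eq_zero {A : Type*} [CommRing A] (hA : FormallyRealFour A)
    {x y : A} (h : x ^ 2 + y ^ 2 = 0) : x = 0 ∧ y = 0 := by
  obtain ⟨hx, hy, -⟩ := hA x y 0 0 (by linear_combination h)
  exact ⟨hx, hy⟩

theorem FormallyRealFour.eq_zero_or_eq_zero_of_dot_of_cross {A : Type*} [CommRing A] [IsDomain A]
    (hA : FormallyRealFour A) {u₁ u₂ w₁ w₂ : A} (hdot : u₁ * w₁ + u₂ * w₂ = 0)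
    (hcross : u₁ * w₂ - u₂ * w₁ = 0) : (u₁ = 0 ∧ u₂ = 0) ∨ (w₁ = 0 ∧ w₂ = 0) := by
  have h : (u₁ ^ 2 + u₂ ^ 2) * (w₁ ^ 2 + w₂ ^ 2) = 0 := by
    linear_combination (u₁ * w₁ + u₂ * w₂) * hdot + (u₁ * w₂ - u₂ * w₁) * hcross
  exact (mul_eq_zero.mp h).imp hA.sq_add_sq_eq_zero hA.sq_add_sq_eq_zero

/-- The coordinate form of the conjugation criterion. -/
theorem exists_conjugation_coords_iff {A : Type*} [CommRing A] [IsDomain A] [Algebra ℝ A]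
    (hA : FormallyRealFour A) {a b : ℝ} (hb : b ≠ 0) (hab : a ^ 2 + b ^ 2 = 1)
    {f : A} (hf : f ≠ 0) (h₀ h₁ h₂ h₃ : A) :
    (∃ c : A, f * (h₀ ^ 2 + h₁ ^ 2 - h₂ ^ 2 - h₃ ^ 2) = c * algebraMap ℝ A a ∧
        f * (2 * (h₁ * h₂ + h₀ * h₃)) = c * algebraMap ℝ A b ∧
        f * (2 * (h₁ * h₃ - h₀ * h₂)) = 0) ↔
      ∃ ε : ℝ, (ε = 1 ∨ ε = -1) ∧ h₂ = -(algebraMap ℝ A ((a + ε) / b) * h₁) ∧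
        h₃ = -(algebraMap ℝ A ((a + ε) / b) * h₀) := by
  have hinj : Function.Injective (algebraMap ℝ A) := (algebraMap ℝ A).injective
  have : CharZero A := charZero_of_injective_algebraMap hinj
  set β := algebraMap ℝ A b with hβdef
  set α := algebraMap ℝ A a with hαdef
  have hβ : β ≠ 0 := by simpa [hβdef] using hb
  constructor
  · rintro ⟨c, hI, hJ, hK⟩
    have hcross : h₁ * h₃ - h₀ * h₂ = 0 := by simpa [hf] using hK
    have hquad : β * (h₀ ^ 2 + h₁ ^ 2 - h₂ ^ 2 - h₃ ^ 2) = α * (2 * (h₁ * h₂ + h₀ * h₃)) :=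
      mul_left_cancel₀ hf (by linear_combination β * hI - α * hJ)
    set t₁ := algebraMap ℝ A ((a + 1) / b) with ht₁
    set t₂ := algebraMap ℝ A ((a + -1) / b) with ht₂
    have hprod : t₁ * t₂ = -1 := by
      rw [ht₁, ht₂, ← map_mul, ← map_one (algebraMap ℝ A), ← map_neg]
      congr 1
      field_simp
      linear_combination hab
    have hsum : β * (t₁ + t₂) = 2 * α := by
      rw [ht₁, ht₂, ← map_add, hβdef, ← map_mul, hαdef, ← map_ofNat (algebraMap ℝ A) 2, ← map_mul]
      congr 1
      field_simp
      ring
    have hdot : (h₃ + t₁ * h₀) * (h₃ + t₂ * h₀) + (h₂ + t₁ * h₁) * (h₂ + t₂ * h₁) = 0 := by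
      apply (mul_eq_zero.mp _).resolve_left hβ
      linear_combination -hquad + (h₁ * h₂ + h₀ * h₃) * hsum + β * (h₀ ^ 2 + h₁ ^ 2) * hprod
    have hcross' : (h₃ + t₁ * h₀) * (h₂ + t₂ * h₁) - (h₂ + t₁ * h₁) * (h₃ + t₂ * h₀) = 0 := by
      linear_combination (t₂ - t₁) * hcross
    rcases hA.eq_zero_or_eq_zero_of_dot_of_cross hdot hcross' with ⟨h, h'⟩ | ⟨h, h'⟩
    · exact ⟨1, .inl rfl, eq_neg_of_add_eq_zero_left h', eq_neg_of_add_eq_zero_left h⟩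
    · exact ⟨-1, .inr rfl, eq_neg_of_add_eq_zero_left h', eq_neg_of_add_eq_zero_left h⟩
  · rintro ⟨ε, hε, h₂_eq, h₃_eq⟩
    have hε_sq : ε ^ 2 = 1 := by rcases hε with rfl | rfl <;> norm_num
    set t := algebraMap ℝ A ((a + ε) / b) with ht
    set s := algebraMap ℝ A b⁻¹ with hs
    have hsb : s * β = 1 := by rw [hs, hβdef, ← map_mul, inv_mul_cancel₀ hb, map_one]
    have hts : t ^ 2 = 1 + 2 * t * s * α := by
      rw [ht, hs, hαdef, ← map_ofNat (algebraMap ℝ A) 2, ← map_one (algebraMap ℝ A)]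
      simp only [← map_mul, ← map_add, ← map_pow]
      congr 1
      field_simp
      linear_combination hε_sq - hab
    refine ⟨-2 * t * s * f * (h₀ ^ 2 + h₁ ^ 2), ?_, ?_, ?_⟩ <;> subst h₂_eq h₃_eq
    · linear_combination -f * (h₀ ^ 2 + h₁ ^ 2) * hts
    · linear_combination 2 * t * f * (h₀ ^ 2 + h₁ ^ 2) * hsb
    · ring

theorem conjugation_sliced_iff_case_distinct_slices
    {A : Type*} [CommRing A] [IsDomain A] [Algebra ℝ A] (hFR : FormallyRealFour A)
    (I₀ M₀ : Quaternion ℝ) (hI₀ : IsImaginaryUnit I₀) (hM₀ : IsImaginaryUnit M₀)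
    (hind : LinearIndependent ℝ ![I₀, M₀])
    (a b : ℝ) (J₀ K₀ : Quaternion ℝ)
    (ha : a = I₀.imI * M₀.imI + I₀.imJ * M₀.imJ + I₀.imK * M₀.imK)
    (hb : b = Real.sqrt (1 - a ^ 2))
    (hK₀ : K₀ = (2 * b)⁻¹ • (I₀ * M₀ - M₀ * I₀))
    (hJ₀ : J₀ = K₀ * I₀)
    (f₀ f₁ : A) (hf₁ : f₁ ≠ 0) (f : Quaternion A)
    (hf : f = (f₀ : Quaternion A) + (f₁ : Quaternion A) * qmap I₀)
    (h : Quaternion A) (hh : ¬ IsSliced I₀ h) :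
    IsSliced M₀ (h * f * star h) ↔
      ∃ ε : ℝ, (ε = 1 ∨ ε = -1) ∧
        ∃ g : Quaternion A, IsSliced I₀ g ∧ g ≠ 0 ∧
          h = (1 - ((a + ε) / b) • qmap K₀) * g := by
  have hpos := one_sub_sq_inner_pos hI₀ hM₀ hind
  rw [← ha] at hpos
  have hb₀ : b ≠ 0 := hb ▸ (Real.sqrt_pos.mpr hpos).ne'
  have hab : a ^ 2 + b ^ 2 = 1 := by
    rw [hb, Real.sq_sqrt hpos.le]
    ring
  obtain ⟨T, hM⟩ := isQuaternionTriple_of_inner hI₀ hM₀ ha hb₀ hab hK₀ hJ₀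
  have hf' : f = T.hom A (ofComponents f₀ f₁ 0 0) := by
    simp [hf, T.hom_apply, Quaternion.coe_mul_eq_smul]
  obtain ⟨h, rfl⟩ := T.hom_surjective h
  have hfactor (t : ℝ) : 1 - t • (qmap K₀ : Quaternion A) =
      T.hom A (ofComponents 1 0 0 (-algebraMap ℝ A t)) := by
    simp [T.hom_apply, sub_eq_add_neg]
  rw [hf', T.star_hom, ← map_mul, ← map_mul, hM, T.isSliced_hom_iff]
  refine (exists_congr fun c ↦ ?_).trans
    ((exists_conjugation_coords_iff hFR hb₀ hab hf₁ h.re h.imI h.imJ h.imK).trans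
      (exists_congr fun ε ↦ and_congr_right fun _ ↦ ?_))
  · refine and_congr ?_ (and_congr ?_ ?_) <;>
      refine iff_of_eq (congrArg (· = _) ?_) <;> simp <;> ring
  · rw [T.hom_surjective.exists]
    simp only [T.isSliced_left_hom_iff, hfactor, ← map_mul,
      T.hom_injective.eq_iff, map_ne_zero_iff _ T.hom_injective]
    constructor
    · rintro ⟨hJ, hK⟩
      refine ⟨ofComponents h.re h.imI 0 0, ⟨rfl, rfl⟩, fun hg ↦ hh ?_, ?_⟩
      · have hre : h.re = 0 := congrArg QuaternionAlgebra.re hg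
        have him : h.imI = 0 := congrArg QuaternionAlgebra.imI hg
        rw [T.isSliced_left_hom_iff, hJ, hK, hre, him]
        simp
      · ext <;> simp [hJ, hK]
    · rintro ⟨g, ⟨hgJ, hgK⟩, -, rfl⟩
      simp [hgJ, hgK]
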